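/- Let Y be a metric space and y ∈ Y. Assume: (i) Y is geodesic, i.e., for all x, z ∈ Y there is an isometric embedding of [0, dist(x,z)] into Y sending 0 to x and dist(x,z) to z; (ii) Y is non-branching; (iii) y is a pole, i.e., for every x ≠ y there is an isometric embedding γ : [0,∞) → Y with γ(0) = y and γ(dist(y,x)) = x. Then for every x ≠ y: (a) any two isometric embeddings γ₁, γ₂ : [0,∞) → Y with γᵢ(0) = y and γᵢ(dist(y,x)) = x coincide; and (b) every point z ∈ Y satisfying |dist(z,y) − dist(x,y)| = dist(x,z) lies on the image of this unique ray through x. -/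

import Mathlib

/-- A metric space is non-branching if any two unit-speed geodesics `γ₁ γ₂ : [a,b] → Y`
that agree on a subinterval of positive length agree on all of `[a,b]`. -/
def NonBranching (Y : Type*) [MetricSpace Y] : Prop :=
  ∀ (a b : ℝ), a < b → ∀ γ₁ γ₂ : ℝ → Y,
    (∀ s ∈ Set.Icc a b, ∀ t ∈ Set.Icc a b, dist (γ₁ s) (γ₁ t) = |s - t|) →
    (∀ s ∈ Set.Icc a b, ∀ t ∈ Set.Icc a b, dist (γ₂ s) (γ₂ t) = |s - t|) →
    (∃ c d : ℝ, a ≤ c ∧ c < d ∧ d ≤ b ∧ ∀ s ∈ Set.Icc c d, γ₁ s = γ₂ s) →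
    ∀ s ∈ Set.Icc a b, γ₁ s = γ₂ s

theorem glue_isom {Y : Type*} [MetricSpace Y] (D E : ℝ) (hD : 0 ≤ D) (hE : D ≤ E)
    (f g : ℝ → Y)
    (hf : ∀ s ∈ Set.Icc 0 D, ∀ t ∈ Set.Icc 0 D, dist (f s) (f t) = |s - t|)
    (hg : ∀ s ∈ Set.Icc D E, ∀ t ∈ Set.Icc D E, dist (g s) (g t) = |s - t|)
    (hfg : f D = g D) (h0 : dist (f 0) (g E) = E) :
    ∃ h : ℝ → Y, (∀ s ∈ Set.Icc 0 E, ∀ t ∈ Set.Icc 0 E, dist (h s) (h t) = |s - t|) ∧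
      (∀ s, s ≤ D → h s = f s) ∧ (∀ s, D ≤ s → h s = g s) := by
  have h1 : ∀ s, s ≤ D → (fun s => if s ≤ D then f s else g s) s = f s := by
    intro s hs; simp [hs]
  have h2 : ∀ s, D ≤ s → (fun s => if s ≤ D then f s else g s) s = g s := by
    intro s hs
    by_cases h : s ≤ D
    · have : s = D := le_antisymm h hs
      subst this; simpa using hfg
    · simp [h]
  refine ⟨fun s => if s ≤ D then f s else g s, ?_, h1, h2⟩
  generalize (fun s => if s ≤ D then f s else g s) = h at h1 h2
  have key : ∀ s t, 0 ≤ s → s ≤ D → D ≤ t → t ≤ E → dist (h s) (h t) = t - s := by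
    intro s t hs hsD hDt ht
    rw [h1 s hsD, h2 t hDt]
    have a1 := hf 0 ⟨le_rfl, hD⟩ s ⟨hs, hsD⟩
    have a2 := hg t ⟨hDt, ht⟩ E ⟨hE, le_rfl⟩
    have a3 := hf s ⟨hs, hsD⟩ D ⟨hD, le_rfl⟩
    have a4 := hg D ⟨le_rfl, hE⟩ t ⟨hDt, ht⟩
    rw [abs_of_nonpos (by linarith)] at a1 a2 a3 a4
    have b1 := dist_triangle (f s) (f D) (g t)
    rw [hfg] at b1 a3
    have b2 := dist_triangle4 (f 0) (f s) (g t) (g E)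
    linarith
  intro s hs t ht
  rcases le_total s D with h3 | h3 <;> rcases le_total t D with h4 | h4
  · rw [h1 s h3, h1 t h4]; exact hf s ⟨hs.1, h3⟩ t ⟨ht.1, h4⟩
  · rw [key s t hs.1 h3 h4 ht.2, abs_of_nonpos (by linarith)]; ring
  · rw [dist_comm, key t s ht.1 h4 h3 hs.2, abs_of_nonneg (by linarith)]
  · rw [h2 s h3, h2 t h4]; exact hg s ⟨h3, hs.2⟩ t ⟨h4, ht.2⟩

/-- In a geodesic, non-branching metric space with a pole `y`, for every
`x ≠ y` the ray from `y` through `x` is unique, and every point `z` in the transport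
relation of `d_y` through `x` lies on that ray. -/
theorem stmt5 {Y : Type*} [MetricSpace Y] (y : Y)
    (hgeo : ∀ x z : Y, ∃ γ : ℝ → Y, γ 0 = x ∧ γ (dist x z) = z ∧
      ∀ s ∈ Set.Icc (0 : ℝ) (dist x z), ∀ t ∈ Set.Icc (0 : ℝ) (dist x z),
        dist (γ s) (γ t) = |s - t|)
    (hnb : NonBranching Y)
    (hpole : ∀ x : Y, x ≠ y → ∃ γ : ℝ → Y,
      (∀ s t : ℝ, 0 ≤ s → 0 ≤ t → dist (γ s) (γ t) = |s - t|) ∧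
      γ 0 = y ∧ γ (dist y x) = x) :
    ∀ x : Y, x ≠ y →
      (∀ γ₁ γ₂ : ℝ → Y,
        (∀ s t : ℝ, 0 ≤ s → 0 ≤ t → dist (γ₁ s) (γ₁ t) = |s - t|) →
        γ₁ 0 = y → γ₁ (dist y x) = x →
        (∀ s t : ℝ, 0 ≤ s → 0 ≤ t → dist (γ₂ s) (γ₂ t) = |s - t|) →
        γ₂ 0 = y → γ₂ (dist y x) = x →
        ∀ t : ℝ, 0 ≤ t → γ₁ t = γ₂ t) ∧
      (∀ γ : ℝ → Y,
        (∀ s t : ℝ, 0 ≤ s → 0 ≤ t → dist (γ s) (γ t) = |s - t|) →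
        γ 0 = y → γ (dist y x) = x →
        ∀ z : Y, |dist z y - dist x y| = dist x z → ∃ t : ℝ, 0 ≤ t ∧ γ t = z) := by
  intro x hx
  have hD : 0 < dist y x := dist_pos.2 (Ne.symm hx)
  constructor
  · intro f g hf hf0 hfD hg hg0 hgD t ht
    set D := dist y x with hDdef
    have hE : D ≤ D + 1 + t := by linarith
    obtain ⟨h, hh, h1, h2⟩ := glue_isom D (D + 1 + t) hD.le hE f g
      (fun s hs t ht => hf s t hs.1 ht.1)
      (fun s hs t ht => hg s t (hD.le.trans hs.1) (hD.le.trans ht.1))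
      (by rw [hfD, hgD])
      (by rw [hf0, ← hg0, hg 0 _ le_rfl (by linarith), abs_of_nonpos (by linarith)]; ring)
    have e1 := hnb 0 (D + 1 + t) (by linarith) h f hh (fun s hs t ht => hf s t hs.1 ht.1)
      ⟨0, D, le_rfl, hD, hE, fun s hs => h1 s hs.2⟩ t ⟨ht, by linarith⟩
    have e2 := hnb 0 (D + 1 + t) (by linarith) h g hh (fun s hs t ht => hg s t hs.1 ht.1)
      ⟨D, D + 1, hD.le, by linarith, by linarith, fun s hs => h2 s hs.1⟩ t ⟨ht, by linarith⟩
    rw [← e1, e2]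
  · intro f hf hf0 hfD z hz
    rw [dist_comm z y, dist_comm x y] at hz
    rcases le_total (dist y x) (dist y z) with hle | hle
    · rw [abs_of_nonneg (by linarith)] at hz
      obtain ⟨σ, hσ0, hσ1, hσ⟩ := hgeo x z
      refine ⟨dist y z, dist_nonneg, ?_⟩
      obtain ⟨h, hh, h1, h2⟩ := glue_isom (dist y x) (dist y z) hD.le hle f
        (fun s => σ (s - dist y x))
        (fun s hs t ht => hf s t hs.1 ht.1)
        (fun s hs t ht => by
          have := hσ (s - dist y x) ⟨by linarith [hs.1], by linarith [hs.2]⟩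
            (t - dist y x) ⟨by linarith [ht.1], by linarith [ht.2]⟩
          simpa using this)
        (by simp [hfD, hσ0])
        (by simp only [hz, hσ1, hf0])
      have e1 := hnb 0 (dist y z) (by linarith) h f hh (fun s hs t ht => hf s t hs.1 ht.1)
        ⟨0, dist y x, le_rfl, hD, hle, fun s hs => h1 s hs.2⟩ (dist y z) ⟨by linarith, le_rfl⟩
      rw [← e1, h2 _ hle]
      simp only [hz, hσ1]
    · rw [abs_of_nonpos (by linarith)] at hz
      have hz' : dist y x - dist y z = dist z x := by rw [dist_comm z x]; linarith
      obtain ⟨τ, hτ0, hτ1, hτ⟩ := hgeo y z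
      obtain ⟨σ, hσ0, hσ1, hσ⟩ := hgeo z x
      refine ⟨dist y z, dist_nonneg, ?_⟩
      obtain ⟨k, hk, k1, k2⟩ := glue_isom (dist y z) (dist y x) dist_nonneg hle τ
        (fun s => σ (s - dist y z)) hτ
        (fun s hs t ht => by
          have := hσ (s - dist y z) ⟨by linarith [hs.1], by linarith [hs.2]⟩
            (t - dist y z) ⟨by linarith [ht.1], by linarith [ht.2]⟩
          simpa using this)
        (by simp [hτ1, hσ0])
        (by simp only [hz', hσ1, hτ0])
      have kx : k (dist y x) = x := by rw [k2 _ hle]; simp only [hz', hσ1]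
      have k0 : k 0 = y := by rw [k1 _ dist_nonneg, hτ0]
      obtain ⟨h, hh, h1, h2⟩ := glue_isom (dist y x) (dist y x + 1) hD.le (by linarith) k f hk
        (fun s hs t ht => hf s t (hD.le.trans hs.1) (hD.le.trans ht.1))
        (by rw [kx, hfD])
        (by rw [k0, ← hf0, hf 0 _ le_rfl (by positivity), abs_of_nonpos (by rw [hf0]; linarith)]; ring)
      have e2 := hnb 0 (dist y x + 1) (by linarith) h f hh (fun s hs t ht => hf s t hs.1 ht.1)
        ⟨dist y x, dist y x + 1, hD.le, by linarith, le_rfl, fun s hs => h2 s hs.1⟩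
        (dist y z) ⟨dist_nonneg, by linarith⟩
      rw [← e2, h1 _ hle, k1 _ le_rfl, hτ1]
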